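/- Let n ≥ 1 be an integer. The affine span (in the real vector space of n×n real matrices) of the set of all n×n permutation matrices has dimension n² − 2n + 1 (equivalently, the Birkhoff polytope B_n, the convex hull of the n×n permutation matrices, has dimension (n−1)²). -/

import Mathlib

open Matrix Finset

/-- The 0/1 permutation matrix of `σ`: entry `(i,j)` equals 1 iff `j = σ i`. -/
def permMat (n : ℕ) (σ : Equiv.Perm (Fin n)) : Matrix (Fin n) (Fin n) ℝ :=
  fun i j => if j = σ i then 1 else 0

/-- `σ` is a tour permutation: an `n`-cycle, i.e. a cycle with support all of `Fin n`. -/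
def IsTourPerm (n : ℕ) (σ : Equiv.Perm (Fin n)) : Prop :=
  σ.IsCycle ∧ σ.support = Finset.univ

/-- The set of tour permutation matrices. -/
def Pt (n : ℕ) : Set (Matrix (Fin n) (Fin n) ℝ) :=
  {M | ∃ σ : Equiv.Perm (Fin n), IsTourPerm n σ ∧ M = permMat n σ}

/-- The set of non-tour permutation matrices. -/
def Pnt (n : ℕ) : Set (Matrix (Fin n) (Fin n) ℝ) :=
  {M | ∃ σ : Equiv.Perm (Fin n), ¬ IsTourPerm n σ ∧ M = permMat n σ}

/-- The all-ones matrix. -/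
def Jmat (n : ℕ) : Matrix (Fin n) (Fin n) ℝ := fun _ _ => 1

/-- The set of stretched tours `Q_t = {(1+ε)·P : P ∈ P_t}`. -/
def Qt (n : ℕ) (ε : ℝ) : Set (Matrix (Fin n) (Fin n) ℝ) :=
  {M | ∃ P ∈ Pt n, M = (1 + ε) • P}

/-- The set of translated non-tours `Q_nt = {P + (ε/n)·J : P ∈ P_nt}`. -/
def Qnt (n : ℕ) (ε : ℝ) : Set (Matrix (Fin n) (Fin n) ℝ) :=
  {M | ∃ P ∈ Pnt n, M = P + (ε / n) • Jmat n}

/-- The inner product `⟨G,Q⟩ = ∑_{i,j} G i j · Q i j`. -/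
def ip (n : ℕ) (G Q : Matrix (Fin n) (Fin n) ℝ) : ℝ :=
  ∑ i, ∑ j, G i j * Q i j

/-- `G` is (the adjacency matrix of) a simple directed graph: 0/1 entries, zero diagonal. -/
def IsSimpleGraphMat (n : ℕ) (G : Matrix (Fin n) (Fin n) ℝ) : Prop :=
  (∀ i j, G i j = 0 ∨ G i j = 1) ∧ ∀ i, G i i = 0

/-- `G` is Hamiltonian: some tour permutation has all its arcs in `G`. -/
def IsHamiltonian (n : ℕ) (G : Matrix (Fin n) (Fin n) ℝ) : Prop :=
  ∃ σ : Equiv.Perm (Fin n), IsTourPerm n σ ∧ ∀ i, G i (σ i) = 1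

/-- The set of all `n × n` permutation matrices. -/
def permMatSet (n : ℕ) : Set (Matrix (Fin n) (Fin n) ℝ) :=
  {M | ∃ σ : Equiv.Perm (Fin n), M = permMat n σ}

/-- The linear map deleting the first row and the first column of a matrix. -/
def deleteFirst (m : ℕ) :
    Matrix (Fin (m + 1)) (Fin (m + 1)) ℝ →ₗ[ℝ] Matrix (Fin m) (Fin m) ℝ where
  toFun A := A.submatrix Fin.succ Fin.succ
  map_add' _ _ := rfl
  map_smul' _ _ := rfl

@[simp]
lemma deleteFirst_apply (m : ℕ) (A : Matrix (Fin (m + 1)) (Fin (m + 1)) ℝ) (i j : Fin m) :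
    deleteFirst m A i j = A i.succ j.succ :=
  rfl

/-- The submodule of matrices all of whose row sums and column sums vanish. -/
def zeroLineSums (n : ℕ) : Submodule ℝ (Matrix (Fin n) (Fin n) ℝ) where
  carrier := {M | (∀ i, ∑ j, M i j = 0) ∧ ∀ j, ∑ i, M i j = 0}
  zero_mem' := by simp
  add_mem' := by
    rintro A B ⟨hA, hA'⟩ ⟨hB, hB'⟩
    simp [Finset.sum_add_distrib, hA, hA', hB, hB']
  smul_mem' := by
    rintro c A ⟨hA, hA'⟩
    simp [← Finset.mul_sum, hA, hA']

lemma permMat_row_sum (n : ℕ) (σ : Equiv.Perm (Fin n)) (i : Fin n) :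
    ∑ j, permMat n σ i j = 1 := by
  simp [permMat]

lemma permMat_col_sum (n : ℕ) (σ : Equiv.Perm (Fin n)) (j : Fin n) :
    ∑ i, permMat n σ i j = 1 := by
  simp [permMat, ← Equiv.symm_apply_eq]

lemma vectorSpan_permMatSet_le (n : ℕ) : vectorSpan ℝ (permMatSet n) ≤ zeroLineSums n := by
  rw [vectorSpan_def, Submodule.span_le]
  rintro _ ⟨_, ⟨σ, rfl⟩, _, ⟨τ, rfl⟩, rfl⟩
  constructor <;> intro i <;>
    simp [Finset.sum_sub_distrib, permMat_row_sum, permMat_col_sum]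

lemma eq_zero_of_deleteFirst_eq_zero {m : ℕ} {M : Matrix (Fin (m + 1)) (Fin (m + 1)) ℝ}
    (hM : M ∈ zeroLineSums (m + 1)) (h : deleteFirst m M = 0) : M = 0 := by
  obtain ⟨hrow, hcol⟩ := hM
  have hss (i j : Fin m) : M i.succ j.succ = 0 := congrFun (congrFun h i) j
  have hs0 (i : Fin m) : M i.succ 0 = 0 := by
    simpa [Fin.sum_univ_succ, hss] using hrow i.succ
  have h0 (j : Fin (m + 1)) : M 0 j = 0 := by
    cases j using Fin.cases with
    | zero => simpa [Fin.sum_univ_succ, hs0] using hcol 0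
    | succ j => simpa [Fin.sum_univ_succ, hss] using hcol j.succ
  ext i j
  cases i using Fin.cases with
  | zero => exact h0 j
  | succ i =>
    cases j using Fin.cases with
    | zero => exact hs0 i
    | succ j => exact hss i j

lemma deleteFirst_permMat_sub (m : ℕ) (k l : Fin m) :
    deleteFirst m (permMat (m + 1) (Equiv.swap k.succ l.succ) -
      permMat (m + 1) (Equiv.swap k.succ l.succ * Equiv.swap 0 k.succ)) =
      Matrix.single k l 1 := by
  ext i j
  by_cases hi : i = k
  · subst hi
    have h : Equiv.swap i.succ l.succ 0 = 0 :=
      Equiv.swap_apply_of_ne_of_ne (Fin.succ_ne_zero _).symm (Fin.succ_ne_zero _).symm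
    simp [permMat, Matrix.single_apply, h, eq_comm (a := j)]
  · have h : Equiv.swap 0 k.succ i.succ = i.succ :=
      Equiv.swap_apply_of_ne_of_ne (Fin.succ_ne_zero _) (by simpa using hi)
    simp [permMat, h, Ne.symm hi]

lemma map_deleteFirst_vectorSpan (m : ℕ) :
    (vectorSpan ℝ (permMatSet (m + 1))).map (deleteFirst m) = ⊤ := by
  rw [eq_top_iff]
  rintro A -
  rw [Matrix.matrix_eq_sum_single A]
  refine Submodule.sum_mem _ fun k _ => Submodule.sum_mem _ fun l _ => ?_
  have h : Matrix.single k l (A k l) = A k l • Matrix.single k l (1 : ℝ) := by simp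
  rw [h, ← deleteFirst_permMat_sub]
  exact Submodule.smul_mem _ _ (Submodule.mem_map_of_mem
    (vsub_mem_vectorSpan ℝ ⟨_, rfl⟩ ⟨_, rfl⟩))

lemma finrank_vectorSpan_permMatSet (m : ℕ) :
    Module.finrank ℝ (vectorSpan ℝ (permMatSet (m + 1))) = m ^ 2 := by
  have hinj : Function.Injective
      ((deleteFirst m).domRestrict (vectorSpan ℝ (permMatSet (m + 1)))) := by
    rw [injective_iff_map_eq_zero]
    intro M h
    exact Subtype.ext (eq_zero_of_deleteFirst_eq_zero (vectorSpan_permMatSet_le _ M.2) h)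
  rw [← LinearMap.finrank_range_of_inj hinj, LinearMap.range_domRestrict,
    map_deleteFirst_vectorSpan, finrank_top, Module.finrank_matrix]
  simp [sq]

theorem stmt6 (n : ℕ) (hn : 1 ≤ n) :
    Module.finrank ℝ
        (affineSpan ℝ {M : Matrix (Fin n) (Fin n) ℝ |
          ∃ σ : Equiv.Perm (Fin n), M = permMat n σ}).direction
      = (n - 1) ^ 2 := by
  obtain ⟨m, rfl⟩ := Nat.exists_eq_add_of_le' hn
  rw [direction_affineSpan, Nat.add_sub_cancel]
  exact finrank_vectorSpan_permMatSet m
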